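/- arXiv:math/0405383 — 2 statements merged into one kernel-verified Lean document; each statement's English description precedes it below -/
import Mathlib

section
/- Let d = 2m be even with m ≥ 2, and let k_j = k₁ for odd j and k_j = k₂ for even j. Suppose k₁ + k₂ = r/m where r is a positive integer not divisible by m. Then the ℂ-vector space of homogeneous singular polynomials of degree r, {f ∈ ℂ[Z,W] : f is homogeneous of degree r and D_Z(f) = D_W(f) = 0}, has dimension at least 2. -/
open MvPolynomial
open scoped Classical

noncomputable section

/-- The polynomial ring `ℂ[Z,W]`, with `Z = X 0` and `W = X 1`. -/
abbrev R2 : Type := MvPolynomial (Fin 2) ℂ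

/-- `ζ = exp(2πi/d)`. -/
def zeta (d : ℕ) : ℂ := Complex.exp (2 * Real.pi * Complex.I / d)

/-- The action of the reflection `s_j` of `I₂(d)` on `ℂ[Z,W]`:
`Z ↦ ζ^j·W`, `W ↦ ζ^{-j}·Z`. -/
def reflAct (d j : ℕ) : R2 →ₐ[ℂ] R2 :=
  aeval ![C (zeta d ^ j) * X 1, C ((zeta d ^ j)⁻¹) * X 0]

/-- Exact division: if `a ∣ b` in `ℂ[Z,W]` this is the (unique, when `a ≠ 0`)
quotient, and `0` otherwise. -/
def exQuot (a b : R2) : R2 := if h : ∃ c, b = a * c then Classical.choose h else 0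

/-- The Dunkl operator `D_Z` with parameters `k₁,…,k_d`. -/
def DZ (d : ℕ) (k : ℕ → ℂ) (f : R2) : R2 :=
  pderiv (0 : Fin 2) f - ∑ j ∈ Finset.Icc 1 d,
    C (k j) * exQuot (X 0 - C (zeta d ^ j) * X 1) (f - reflAct d j f)

/-- The Dunkl operator `D_W` with parameters `k₁,…,k_d`. -/
def DW (d : ℕ) (k : ℕ → ℂ) (f : R2) : R2 :=
  pderiv (1 : Fin 2) f - ∑ j ∈ Finset.Icc 1 d,
    C (k j) * exQuot (X 1 - C ((zeta d ^ j)⁻¹) * X 0) (f - reflAct d j f)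

theorem exQuot_eq {a b q : R2} (ha : a ≠ 0) (h : b = a * q) : exQuot a b = q := by
  have hex : ∃ c, b = a * c := ⟨q, h⟩
  rw [exQuot, dif_pos hex]
  exact mul_left_cancel₀ ha ((Classical.choose_spec hex).symm.trans h)

theorem X_sub_C_mul_X_ne_zero {x y : Fin 2} (hxy : x ≠ y) (w : ℂ) :
    (X x - C w * X y : R2) ≠ 0 := by
  intro h
  have := congrArg (eval (fun i => if i = x then (1 : ℂ) else 0)) h
  simp [hxy.symm] at this

/-- The weighted sum of the reflection quotients of `x ^ a * y ^ b` with `m ∣ b` only involves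
monomials whose exponent of `y` is congruent to `-1` modulo `m`. -/
theorem exists_reflection_quotient {J : Finset ℕ} {m : ℕ} {k w : ℕ → ℂ} (hw : ∀ j, w j ≠ 0)
    (hpos : ∀ n, ¬ m ∣ n → ∑ j ∈ J, k j * w j ^ n = 0)
    (hneg : ∀ n, ¬ m ∣ n → ∑ j ∈ J, k j * (w j)⁻¹ ^ n = 0)
    (x y : Fin 2) {a b : ℕ} (hb : m ∣ b) :
    ∃ Q : ℕ → R2,
      (∀ j, (X x ^ a * X y ^ b - (C (w j) * X y) ^ a * (C (w j)⁻¹ * X x) ^ b : R2) =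
        (X y - C (w j)⁻¹ * X x) * Q j) ∧
      ∑ j ∈ J, C (k j) * Q j ∈ Submodule.span ℂ
        {p : R2 | ∃ e g, e + g + 1 = a + b ∧ m ∣ g + 1 ∧ p = X x ^ e * X y ^ g} := by
  have hCw (j : ℕ) : (C (w j) * C (w j)⁻¹ : R2) = 1 := by
    rw [← C_mul, mul_inv_cancel₀ (hw j), C_1]
  have hgeom (j n : ℕ) : (X y ^ n - (C (w j)⁻¹ * X x) ^ n : R2) = (X y - C (w j)⁻¹ * X x) *
      ∑ i ∈ Finset.range n, X y ^ i * (C (w j)⁻¹ * X x) ^ (n - 1 - i) := by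
    rw [mul_comm (X y - _), geom_sum₂_mul]
  rcases le_total a b with hab | hab
  · obtain ⟨n, rfl⟩ := Nat.exists_eq_add_of_le hab
    refine ⟨fun j => (X x * X y) ^ a *
      ∑ i ∈ Finset.range n, X y ^ i * (C (w j)⁻¹ * X x) ^ (n - 1 - i), fun j => ?_, ?_⟩
    · have h1 : (C (w j) ^ a * C (w j)⁻¹ ^ a : R2) = 1 := by rw [← mul_pow, hCw, one_pow]
      calc _ = (X x * X y) ^ a * (X y ^ n - (C (w j)⁻¹ * X x) ^ n : R2) := by
            linear_combination -(X x * X y) ^ a * (C (w j)⁻¹ * X x) ^ n * h1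
        _ = _ := by rw [hgeom]; ring
    · have : ∑ j ∈ J, C (k j) * ((X x * X y) ^ a *
          ∑ i ∈ Finset.range n, X y ^ i * (C (w j)⁻¹ * X x) ^ (n - 1 - i)) =
          ∑ i ∈ Finset.range n, (∑ j ∈ J, k j * (w j)⁻¹ ^ (n - 1 - i)) •
            (X x ^ (a + (n - 1 - i)) * X y ^ (a + i) : R2) := by
        simp only [Finset.mul_sum, Finset.sum_smul]
        rw [Finset.sum_comm]
        refine Finset.sum_congr rfl fun i _ => Finset.sum_congr rfl fun j _ => ?_
        rw [smul_eq_C_mul, C_mul, C_pow]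
        ring
      rw [this]
      refine Submodule.sum_mem _ fun i hi => ?_
      have hin := Finset.mem_range.mp hi
      by_cases hd : m ∣ n - 1 - i
      · refine Submodule.smul_mem _ _ (Submodule.subset_span ⟨_, _, by omega, ?_, rfl⟩)
        rw [show a + n = (a + i + 1) + (n - 1 - i) by omega] at hb
        exact (Nat.dvd_add_left hd).mp hb
      · rw [hneg _ hd, zero_smul]
        exact Submodule.zero_mem _
  · obtain ⟨n, rfl⟩ := Nat.exists_eq_add_of_le hab
    refine ⟨fun j => -((X x * X y) ^ b * C (w j) ^ n *
      ∑ i ∈ Finset.range n, X y ^ i * (C (w j)⁻¹ * X x) ^ (n - 1 - i)), fun j => ?_, ?_⟩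
    · have h1 : (C (w j) ^ b * C (w j)⁻¹ ^ b : R2) = 1 := by rw [← mul_pow, hCw, one_pow]
      have h2 : (C (w j) ^ n * C (w j)⁻¹ ^ n : R2) = 1 := by rw [← mul_pow, hCw, one_pow]
      calc _ = -((X x * X y) ^ b * C (w j) ^ n * (X y ^ n - (C (w j)⁻¹ * X x) ^ n) : R2) := by
            linear_combination -(X x * X y) ^ b * C (w j) ^ n * X y ^ n * h1
              - (X x * X y) ^ b * X x ^ n * h2
        _ = _ := by rw [hgeom]; ring
    · have : ∑ j ∈ J, C (k j) * -((X x * X y) ^ b * C (w j) ^ n *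
          ∑ i ∈ Finset.range n, X y ^ i * (C (w j)⁻¹ * X x) ^ (n - 1 - i)) =
          ∑ i ∈ Finset.range n, (-∑ j ∈ J, k j * w j ^ (i + 1)) •
            (X x ^ (b + (n - 1 - i)) * X y ^ (b + i) : R2) := by
        simp only [Finset.mul_sum, Finset.sum_smul, ← Finset.sum_neg_distrib]
        rw [Finset.sum_comm]
        refine Finset.sum_congr rfl fun i hi => Finset.sum_congr rfl fun j _ => ?_
        have hin := Finset.mem_range.mp hi
        have h2 : (C (w j) ^ (n - 1 - i) * C (w j)⁻¹ ^ (n - 1 - i) : R2) = 1 := by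
          rw [← mul_pow, hCw, one_pow]
        have h3 : (C (w j) ^ n : R2) = C (w j) ^ (i + 1) * C (w j) ^ (n - 1 - i) := by
          rw [← pow_add]; congr 1; omega
        rw [smul_eq_C_mul, C_neg, C_mul, C_pow, h3]
        linear_combination -C (k j) * C (w j) ^ (i + 1) *
          X x ^ (b + (n - 1 - i)) * X y ^ (b + i) * h2
      rw [this]
      refine Submodule.sum_mem _ fun i hi => ?_
      have hin := Finset.mem_range.mp hi
      by_cases hd : m ∣ i + 1
      · refine Submodule.smul_mem _ _ (Submodule.subset_span ⟨_, _, by omega, ?_, rfl⟩)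
        exact (Nat.dvd_add_right hb).mpr hd
      · rw [hpos _ hd, neg_zero, zero_smul]
        exact Submodule.zero_mem _

/-- The weighted sum of the reflections annihilates `x ^ a * y ^ b` if `m` divides `b`
but not `a`. -/
theorem sum_reflection_eq_zero {J : Finset ℕ} {m : ℕ} {k w : ℕ → ℂ} (hw : ∀ j, w j ≠ 0)
    (hpos : ∀ n, ¬ m ∣ n → ∑ j ∈ J, k j * w j ^ n = 0)
    (hneg : ∀ n, ¬ m ∣ n → ∑ j ∈ J, k j * (w j)⁻¹ ^ n = 0)
    (x y : Fin 2) {a b : ℕ} (ha : ¬ m ∣ a) (hb : m ∣ b) :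
    ∑ j ∈ J, C (k j) * ((C (w j) * X y) ^ a * (C (w j)⁻¹ * X x) ^ b : R2) = 0 := by
  have hs : ∑ j ∈ J, k j * (w j ^ a * (w j)⁻¹ ^ b) = 0 := by
    rcases le_total a b with hab | hab
    · obtain ⟨n, rfl⟩ := Nat.exists_eq_add_of_le hab
      rw [← hneg n fun hn => ha ((Nat.dvd_add_left hn).mp hb)]
      refine Finset.sum_congr rfl fun j _ => ?_
      have := hw j
      rw [pow_add, ← mul_assoc (w j ^ a), ← mul_pow, mul_inv_cancel₀ this, one_pow, one_mul]
    · obtain ⟨n, rfl⟩ := Nat.exists_eq_add_of_le hab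
      rw [← hpos n fun hn => ha ((Nat.dvd_add_right hb).mpr hn)]
      refine Finset.sum_congr rfl fun j _ => ?_
      have := hw j
      rw [pow_add, mul_right_comm (w j ^ b), ← mul_pow, mul_inv_cancel₀ this, one_pow, one_mul]
  calc _ = C (∑ j ∈ J, k j * (w j ^ a * (w j)⁻¹ ^ b)) * (X x ^ b * X y ^ a : R2) := by
        rw [map_sum, Finset.sum_mul]
        refine Finset.sum_congr rfl fun j _ => ?_
        simp only [C_mul, C_pow]
        ring
    _ = 0 := by rw [hs, C_0, zero_mul]

theorem X_pow_mul_X_pow_eq_monomial (x y : Fin 2) (a b : ℕ) :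
    (X x ^ a * X y ^ b : R2) = monomial (Finsupp.single x a + Finsupp.single y b) 1 := by
  rw [X_pow_eq_monomial, X_pow_eq_monomial, monomial_mul, one_mul]

/-- For a weighted family of reflections `X x ↦ w X y`, `X y ↦ w⁻¹ X x` whose weighted power sums
vanish outside the multiples of `m`, there is a nonzero homogeneous polynomial of degree `r`
killed by both Dunkl operators, in which all exponents of `X y` are divisible by `m`. -/
theorem exists_singular {J : Finset ℕ} {m r : ℕ} {k w : ℕ → ℂ} (hm : 0 < m) (hrm : ¬ m ∣ r)
    (hw : ∀ j, w j ≠ 0) (hsum : ∑ j ∈ J, k j = r)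
    (hpos : ∀ n, ¬ m ∣ n → ∑ j ∈ J, k j * w j ^ n = 0)
    (hneg : ∀ n, ¬ m ∣ n → ∑ j ∈ J, k j * (w j)⁻¹ ^ n = 0)
    {x y : Fin 2} (hxy : x ≠ y) (σ : ℕ → R2 →ₐ[ℂ] R2)
    (hσx : ∀ j, σ j (X x) = C (w j) * X y) (hσy : ∀ j, σ j (X y) = C (w j)⁻¹ * X x) :
    ∃ f : R2, f ≠ 0 ∧ f.IsHomogeneous r ∧ (∀ s, coeff s f ≠ 0 → m ∣ s y) ∧
      pderiv x f - ∑ j ∈ J, C (k j) * exQuot (X x - C (w j) * X y) (f - σ j f) = 0 ∧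
      pderiv y f - ∑ j ∈ J, C (k j) * exQuot (X y - C (w j)⁻¹ * X x) (f - σ j f) = 0 := by
  set T := r / m with hT
  have hle (t : Fin (T + 1)) : m * t ≤ r :=
    (Nat.mul_le_mul_left m (Nat.lt_succ_iff.mp t.2)).trans (Nat.mul_div_le r m)
  choose Q hQ hQmem using fun t : Fin (T + 1) =>
    exists_reflection_quotient hw hpos hneg x y (a := r - m * t) (b := m * t) (Dvd.intro _ rfl)
  let M : Fin (T + 1) → R2 := fun t => X x ^ (r - m * t) * X y ^ (m * (t : ℕ))
  have hσM (t : Fin (T + 1)) (j : ℕ) : σ j (M t) =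
      (C (w j) * X y) ^ (r - m * t) * (C (w j)⁻¹ * X x) ^ (m * (t : ℕ)) := by
    simp only [M, map_mul, map_pow, hσx, hσy]
  let U : Submodule ℂ R2 := Submodule.span ℂ
    (Set.range fun t : Fin T => (X x ^ (r - m * (t + 1)) * X y ^ (m * ((t : ℕ) + 1) - 1) : R2))
  let E : Fin (T + 1) → R2 := fun t => pderiv y (M t) - ∑ j ∈ J, C (k j) * Q t j
  have hgen {e g : ℕ} (h : e + g + 1 = r) (hd : m ∣ g + 1) : (X x ^ e * X y ^ g : R2) ∈ U := by
    obtain ⟨t, ht⟩ := hd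
    have htT : t ≤ T := (Nat.le_div_iff_mul_le hm).mpr (by rw [mul_comm]; omega)
    have ht0 : t ≠ 0 := by rintro rfl; simp at ht
    obtain ⟨u, rfl⟩ := Nat.exists_eq_succ_of_ne_zero ht0
    refine Submodule.subset_span ⟨⟨u, htT⟩, ?_⟩
    simp only [Nat.succ_eq_add_one] at ht
    simp only [← ht]
    congr 2
    omega
  have hE (t : Fin (T + 1)) : E t ∈ U := by
    refine Submodule.sub_mem _ ?_ ?_
    · have : pderiv y (M t) =
          ((m * (t : ℕ) : ℕ) : ℂ) • (X x ^ (r - m * t) * X y ^ (m * (t : ℕ) - 1) : R2) := by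
        simp only [M, Derivation.leibniz, Derivation.leibniz_pow, pderiv_X_self,
          pderiv_X_of_ne hxy, smul_eq_C_mul, smul_eq_mul, nsmul_eq_mul, map_natCast]
        ring
      rw [this]
      rcases Nat.eq_zero_or_pos (m * (t : ℕ)) with h0 | h0
      · rw [h0, Nat.cast_zero, zero_smul]
        exact Submodule.zero_mem _
      · have := hle t
        refine Submodule.smul_mem _ _ (hgen (by omega) ?_)
        rw [Nat.sub_add_cancel h0]
        exact Dvd.intro _ rfl
    · refine Submodule.span_le.mpr ?_ (hQmem t)
      rintro _ ⟨e, g, h, hd, rfl⟩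
      have := hle t
      exact hgen (by omega) hd
  obtain ⟨c, hc, t₀, ht₀⟩ : ∃ c : Fin (T + 1) → ℂ, ∑ t, c t • E t = 0 ∧ ∃ t, c t ≠ 0 := by
    have hdep : ¬ LinearIndependent ℂ (fun t => (⟨E t, hE t⟩ : U)) := by
      intro hli
      have : FiniteDimensional ℂ U := FiniteDimensional.span_of_finite ℂ (Set.finite_range _)
      have h1 := hli.fintype_card_le_finrank
      have h2 : Module.finrank ℂ U ≤ Fintype.card (Fin T) := finrank_range_le_card _
      simp only [Fintype.card_fin] at h1 h2
      omega
    obtain ⟨c, hc, t, ht⟩ := Fintype.not_linearIndependent_iff.mp hdep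
    refine ⟨c, ?_, t, ht⟩
    simpa using congrArg Subtype.val hc
  set f : R2 := ∑ t, c t • M t with hf
  have hcoeff (s : Fin 2 →₀ ℕ) : coeff s f = ∑ t : Fin (T + 1), c t *
      if Finsupp.single x (r - m * (t : ℕ)) + Finsupp.single y (m * (t : ℕ)) = s
        then 1 else 0 := by
    simp only [hf, M, X_pow_mul_X_pow_eq_monomial, coeff_sum, coeff_smul, coeff_monomial,
      smul_eq_mul]
  have hfj (j : ℕ) : f - σ j f = (X y - C (w j)⁻¹ * X x) * ∑ t, c t • Q t j := by
    simp only [hf, map_sum, map_smul, ← Finset.sum_sub_distrib, ← smul_sub, Finset.mul_sum,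
      mul_smul_comm, hσM, M, hQ]
  have hfj' (j : ℕ) : f - σ j f =
      (X x - C (w j) * X y) * (-(C (w j)⁻¹ * ∑ t, c t • Q t j)) := by
    have hC : (C (w j) * C (w j)⁻¹ : R2) = 1 := by
      rw [← C_mul, mul_inv_cancel₀ (hw j), C_1]
    rw [hfj]
    linear_combination -(X y * ∑ t, c t • Q t j) * hC
  have hhom : f.IsHomogeneous r := by
    refine IsHomogeneous.sum _ _ _ fun t _ => ?_
    rw [smul_eq_C_mul]
    refine IsHomogeneous.C_mul ?_ _
    have h := (isHomogeneous_X_pow (R := ℂ) x (r - m * t)).mul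
      (isHomogeneous_X_pow (R := ℂ) y (m * (t : ℕ)))
    rwa [Nat.sub_add_cancel (hle t)] at h
  have hDy : pderiv y f - ∑ j ∈ J, C (k j) * ∑ t, c t • Q t j = 0 := by
    rw [← hc]
    simp only [hf, E, map_sum, Derivation.map_smul, smul_sub, Finset.sum_sub_distrib, Finset.mul_sum,
      Finset.smul_sum, mul_smul_comm]
    rw [Finset.sum_comm]
  have heuler : X x * pderiv x f + X y * pderiv y f = (r : R2) * f := by
    have h := hhom.sum_X_mul_pderiv
    rw [nsmul_eq_mul, Fin.sum_univ_two] at h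
    rcases Fin.exists_fin_two.mp ⟨x, rfl⟩ with rfl | rfl <;>
      rcases Fin.exists_fin_two.mp ⟨y, rfl⟩ with rfl | rfl
    · exact absurd rfl hxy
    · exact h
    · rw [add_comm]; exact h
    · exact absurd rfl hxy
  have hσf : ∑ j ∈ J, C (k j) * σ j f = 0 := by
    simp only [hf, map_sum, map_smul, Finset.mul_sum, mul_smul_comm, hσM]
    rw [Finset.sum_comm]
    refine Finset.sum_eq_zero fun t _ => ?_
    rw [← Finset.smul_sum, sum_reflection_eq_zero hw hpos hneg x y ?_ (Dvd.intro _ rfl),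
      smul_zero]
    rwa [Nat.dvd_sub_iff_left (hle t) (Dvd.intro _ rfl)]
  have hDx : pderiv x f - ∑ j ∈ J, C (k j) * (-(C (w j)⁻¹ * ∑ t, c t • Q t j)) = 0 := by
    refine (mul_eq_zero.mp ?_).resolve_left (X_ne_zero x : (X x : R2) ≠ 0)
    have h1 : ∑ j ∈ J, C (k j) * (f - σ j f) = (r : R2) * f := by
      simp only [mul_sub, Finset.sum_sub_distrib]
      rw [hσf, sub_zero, ← Finset.sum_mul, ← map_sum, hsum, map_natCast]
    have h2 : ∑ j ∈ J, C (k j) * (f - σ j f) =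
        X x * ∑ j ∈ J, C (k j) * (-(C (w j)⁻¹ * ∑ t, c t • Q t j)) +
          X y * ∑ j ∈ J, C (k j) * ∑ t, c t • Q t j := by
      rw [Finset.mul_sum, Finset.mul_sum, ← Finset.sum_add_distrib]
      refine Finset.sum_congr rfl fun j _ => ?_
      rw [hfj]
      ring
    linear_combination heuler - h1 + h2 - X y * hDy
  refine ⟨f, fun h0 => ht₀ ?_, hhom, fun s hs => ?_, ?_, ?_⟩
  · have h := hcoeff (Finsupp.single x (r - m * (t₀ : ℕ)) + Finsupp.single y (m * (t₀ : ℕ)))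
    rw [h0, coeff_zero, Finset.sum_eq_single t₀, if_pos rfl, mul_one] at h
    · exact h.symm
    · intro t _ ht
      rw [if_neg, mul_zero]
      intro he
      have := DFunLike.congr_fun he y
      simp [hxy, hm.ne', Fin.val_inj, ht] at this
    · simp
  · rw [hcoeff] at hs
    obtain ⟨t, -, ht⟩ := Finset.exists_ne_zero_of_sum_ne_zero hs
    have he := of_not_not fun he => ht (by rw [if_neg he, mul_zero])
    rw [← he]
    simp [hxy]
  · simpa only [exQuot_eq (X_sub_C_mul_X_ne_zero hxy _) (hfj' _)] using hDx
  · simpa only [exQuot_eq (X_sub_C_mul_X_ne_zero hxy.symm _) (hfj _)] using hDy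

theorem sum_alternating_mul_pow (m : ℕ) (k₁ k₂ c : ℂ) :
    ∑ j ∈ Finset.Icc 1 (2 * m), (if j % 2 = 1 then k₁ else k₂) * c ^ j =
      (k₁ * c + k₂ * c ^ 2) * ∑ i ∈ Finset.range m, (c ^ 2) ^ i := by
  induction m with
  | zero => simp
  | succ n ih =>
    rw [show 2 * (n + 1) = 2 * n + 1 + 1 by ring, Finset.sum_Icc_succ_top (by omega),
      Finset.sum_Icc_succ_top (by omega), ih, Finset.sum_range_succ, if_pos (by omega),
      if_neg (by omega)]
    ring

theorem sum_alternating_mul_pow_eq_zero {m : ℕ} (k₁ k₂ : ℂ) {c : ℂ} (hc : c ^ (2 * m) = 1)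
    (hc2 : c ^ 2 ≠ 1) :
    ∑ j ∈ Finset.Icc 1 (2 * m), (if j % 2 = 1 then k₁ else k₂) * c ^ j = 0 := by
  rw [sum_alternating_mul_pow, geom_sum_eq hc2, ← pow_mul, hc, sub_self, zero_div, mul_zero]

/-- For even `d = 2m` with `k₁ + k₂ = r/m`, `r` a positive integer not divisible by
`m`, the space of homogeneous singular polynomials of degree `r` has dimension ≥ 2. -/
theorem even_singular_space (m r : ℕ) (hm : 2 ≤ m) (hr : 0 < r) (hrm : ¬ m ∣ r)
    (k₁ k₂ : ℂ) (hsum : k₁ + k₂ = (r : ℂ) / (m : ℂ)) :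
    ∃ f₁ f₂ : R2, LinearIndependent ℂ ![f₁, f₂] ∧
      (f₁.IsHomogeneous r ∧
       DZ (2 * m) (fun j => if j % 2 = 1 then k₁ else k₂) f₁ = 0 ∧
       DW (2 * m) (fun j => if j % 2 = 1 then k₁ else k₂) f₁ = 0) ∧
      (f₂.IsHomogeneous r ∧
       DZ (2 * m) (fun j => if j % 2 = 1 then k₁ else k₂) f₂ = 0 ∧
       DW (2 * m) (fun j => if j % 2 = 1 then k₁ else k₂) f₂ = 0) := by
  have hm0 : m ≠ 0 := by omega
  have hζ : IsPrimitiveRoot (zeta (2 * m)) (2 * m) :=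
    Complex.isPrimitiveRoot_exp (2 * m) (by omega)
  set ζ := zeta (2 * m) with hζdef
  have hζ0 : ζ ≠ 0 := hζ.ne_zero (by omega)
  have hpos (n : ℕ) (hn : ¬ m ∣ n) : ∑ j ∈ Finset.Icc 1 (2 * m),
      (if j % 2 = 1 then k₁ else k₂) * (ζ ^ j) ^ n = 0 := by
    simp only [pow_right_comm _ _ n]
    refine sum_alternating_mul_pow_eq_zero k₁ k₂ ?_ ?_
    · rw [pow_right_comm, hζ.pow_eq_one, one_pow]
    · rw [← pow_mul, mul_comm, Ne, hζ.pow_eq_one_iff_dvd]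
      exact fun h => hn (Nat.dvd_of_mul_dvd_mul_left two_pos h)
  have hneg (n : ℕ) (hn : ¬ m ∣ n) : ∑ j ∈ Finset.Icc 1 (2 * m),
      (if j % 2 = 1 then k₁ else k₂) * (ζ ^ j)⁻¹ ^ n = 0 := by
    simp only [← inv_pow, pow_right_comm _ _ n]
    refine sum_alternating_mul_pow_eq_zero k₁ k₂ ?_ ?_
    · rw [pow_right_comm, hζ.inv.pow_eq_one, one_pow]
    · rw [← pow_mul, mul_comm, Ne, hζ.inv.pow_eq_one_iff_dvd]
      exact fun h => hn (Nat.dvd_of_mul_dvd_mul_left two_pos h)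
  have hk : ∑ j ∈ Finset.Icc 1 (2 * m), (if j % 2 = 1 then k₁ else k₂) = (r : ℂ) := by
    have h := sum_alternating_mul_pow m k₁ k₂ 1
    simp only [one_pow, mul_one, Finset.sum_const, Finset.card_range, nsmul_eq_mul] at h
    rw [h, hsum, div_mul_cancel₀]
    exact_mod_cast hm0
  have hσ0 (j : ℕ) : reflAct (2 * m) j (X 0) = C (ζ ^ j) * X 1 := by simp [reflAct, hζdef]
  have hσ1 (j : ℕ) : reflAct (2 * m) j (X 1) = C (ζ ^ j)⁻¹ * X 0 := by simp [reflAct, hζdef]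
  obtain ⟨f₁, hf₁, hhom₁, hs₁, hZ₁, hW₁⟩ := exists_singular (Nat.pos_of_ne_zero hm0) hrm
    (fun j => pow_ne_zero j hζ0) hk hpos hneg (zero_ne_one' (Fin 2)) (reflAct (2 * m)) hσ0 hσ1
  obtain ⟨f₂, hf₂, hhom₂, hs₂, hW₂, hZ₂⟩ := exists_singular (Nat.pos_of_ne_zero hm0) hrm
    (fun j => inv_ne_zero (pow_ne_zero j hζ0)) hk hneg (by simpa only [inv_inv] using hpos)
    (zero_ne_one' (Fin 2)).symm (reflAct (2 * m)) hσ1 (by simpa only [inv_inv] using hσ0)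
  simp only [inv_inv] at hZ₂
  refine ⟨f₁, f₂, ?_, ⟨hhom₁, hZ₁, hW₁⟩, ⟨hhom₂, hZ₂, hW₂⟩⟩
  have hdisj (s : Fin 2 →₀ ℕ) (h₁ : coeff s f₁ ≠ 0) (h₂ : coeff s f₂ ≠ 0) : False := by
    have hdeg : s.degree = r := by
      rw [Finsupp.degree_eq_weight_one]
      exact hhom₁ h₁
    rw [Finsupp.degree_eq_sum, Fin.sum_univ_two] at hdeg
    exact hrm (hdeg ▸ dvd_add (hs₂ s h₂) (hs₁ s h₁))
  rw [LinearIndependent.pair_iff]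
  intro a b hab
  obtain ⟨s, hs⟩ := ne_zero_iff.mp hf₁
  obtain ⟨u, hu⟩ := ne_zero_iff.mp hf₂
  have h₁ := congrArg (coeff s) hab
  have h₂ := congrArg (coeff u) hab
  simp only [coeff_add, coeff_smul, coeff_zero, smul_eq_mul] at h₁ h₂
  rw [of_not_not fun h => hdisj s hs h, mul_zero, add_zero] at h₁
  rw [of_not_not fun h => hdisj u h hu, mul_zero, zero_add] at h₂
  exact ⟨(mul_eq_zero.mp h₁).resolve_right hs, (mul_eq_zero.mp h₂).resolve_right hu⟩

end
end

section
/- Let d = 2m be even with m ≥ 2, and let k_j = k₁ for odd j and k_j = k₂ for even j. Assume that: (a) k₁ + k₂ ≠ r/m for every positive integer r not divisible by m; (b) k₁ is not of the form i + 1/2 for any integer i ≥ 0; and (c) k₂ is not of the form i + 1/2 for any integer i ≥ 0. Then every polynomial f ∈ ℂ[Z,W] with D_Z(f) = 0 and D_W(f) = 0 is a constant. -/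
open MvPolynomial
open scoped Classical

noncomputable section

/-- The substitution `Z ↦ c·W`, `W ↦ c⁻¹·Z`. -/
def swapAct (c : ℂ) : R2 →ₐ[ℂ] R2 := aeval ![C c * X 1, C c⁻¹ * X 0]

/-- The linear form `Z - c·W`. -/
def rootForm (c : ℂ) : R2 := X 0 - C c * X 1

/-- The divided difference `(f - swapAct c f) / (Z - c·W)`. -/
def divDiff (c : ℂ) (f : R2) : R2 := exQuot (rootForm c) (f - swapAct c f)

@[simp] lemma swapAct_X_zero (c : ℂ) : swapAct c (X 0) = C c * X 1 := by simp [swapAct]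

@[simp] lemma swapAct_X_one (c : ℂ) : swapAct c (X 1) = C c⁻¹ * X 0 := by simp [swapAct]

@[simp] lemma swapAct_C (c a : ℂ) : swapAct c (C a) = C a := (swapAct c).commutes a

lemma mul_exQuot {a b : R2} (h : a ∣ b) : a * exQuot a b = b := by
  have h' : ∃ c, b = a * c := h
  rw [exQuot, dif_pos h']
  exact (Classical.choose_spec h').symm

/-- A form dividing `X i - φ (X i)` for every variable divides `f - φ f` for every `f`. -/
lemma dvd_sub_algHom (φ : R2 →ₐ[ℂ] R2) (a : R2) (h : ∀ i, a ∣ X i - φ (X i)) (f : R2) :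
    a ∣ f - φ f := by
  induction f using MvPolynomial.induction_on with
  | C c => rw [← algebraMap_eq, φ.commutes, sub_self]; exact dvd_zero a
  | add p q hp hq =>
    rw [map_add, add_sub_add_comm]
    exact dvd_add hp hq
  | mul_X p i hp =>
    have e : p * X i - φ (p * X i) = (p - φ p) * X i + φ p * (X i - φ (X i)) := by
      rw [map_mul]; ring
    rw [e]
    exact dvd_add (hp.mul_right _) ((h i).mul_left _)

lemma rootForm_dvd_sub_swapAct {c : ℂ} (hc : c ≠ 0) (f : R2) :
    rootForm c ∣ f - swapAct c f := by
  refine dvd_sub_algHom _ _ (fun i => ?_) f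
  fin_cases i
  · simp [rootForm]
  · refine ⟨-C c⁻¹, ?_⟩
    have : (C c * C c⁻¹ : R2) = 1 := by rw [← C_mul, mul_inv_cancel₀ hc, C_1]
    simp only [Fin.mk_one, swapAct_X_one, rootForm]
    linear_combination -X 1 * this

/-- Restriction to the line `Z = c·W`. -/
def restrictLine (c : ℂ) : R2 →ₐ[ℂ] R2 := aeval ![C c * X 1, X 1]

lemma rootForm_dvd_iff (c : ℂ) (f : R2) : rootForm c ∣ f ↔ restrictLine c f = 0 := by
  constructor
  · rintro ⟨g, rfl⟩
    simp [restrictLine, rootForm]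
  · intro h
    have := dvd_sub_algHom (restrictLine c) (rootForm c) (fun i => by
      fin_cases i <;> simp [restrictLine, rootForm]) f
    rwa [h, sub_zero] at this

lemma rootForm_ne_zero (c : ℂ) : rootForm c ≠ 0 := by
  intro h
  have := congrArg (pderiv (0 : Fin 2)) h
  simp [rootForm, pderiv_X] at this

lemma prime_rootForm (c : ℂ) : Prime (rootForm c) := by
  refine ⟨rootForm_ne_zero c, fun h => ?_, fun a b h => ?_⟩
  · have := (rootForm_dvd_iff c 1).1 h.dvd
    simp at this
  · simpa [rootForm_dvd_iff] using h

lemma rootForm_not_dvd_rootForm {a b : ℂ} (h : a ≠ b) : ¬ rootForm a ∣ rootForm b := by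
  rw [rootForm_dvd_iff]
  have : restrictLine a (rootForm b) = C (a - b) * X 1 := by
    simp [restrictLine, rootForm]; ring
  rw [this]
  simp [sub_eq_zero, h]

lemma rootForm_mul_divDiff {c : ℂ} (hc : c ≠ 0) (f : R2) :
    rootForm c * divDiff c f = f - swapAct c f :=
  mul_exQuot (rootForm_dvd_sub_swapAct hc f)

lemma divDiff_eq {c : ℂ} (hc : c ≠ 0) {f g : R2} (h : f - swapAct c f = rootForm c * g) :
    divDiff c f = g :=
  mul_left_cancel₀ (rootForm_ne_zero c) ((rootForm_mul_divDiff hc f).trans h)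

lemma divDiff_add {c : ℂ} (hc : c ≠ 0) (f g : R2) :
    divDiff c (f + g) = divDiff c f + divDiff c g :=
  divDiff_eq hc (by
    rw [mul_add, rootForm_mul_divDiff hc, rootForm_mul_divDiff hc, map_add]; ring)

lemma divDiff_C {c : ℂ} (hc : c ≠ 0) (a : ℂ) : divDiff c (C a) = 0 :=
  divDiff_eq hc (by simp)

lemma exQuot_opposite {c : ℂ} (hc : c ≠ 0) (f : R2) :
    exQuot (X 1 - C c⁻¹ * X 0) (f - swapAct c f) = -(C c * divDiff c f) := by
  have h1 : (C c * C c⁻¹ : R2) = 1 := by rw [← C_mul, mul_inv_cancel₀ hc, C_1]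
  have h2 : rootForm c = -C c * (X 1 - C c⁻¹ * X 0) := by
    rw [rootForm]; linear_combination -X 0 * h1
  have h3 : (X 1 - C c⁻¹ * X 0 : R2) ≠ 0 := by
    intro h
    apply rootForm_ne_zero c
    rw [h2, h, mul_zero]
  have h4 : f - swapAct c f = (X 1 - C c⁻¹ * X 0) * -(C c * divDiff c f) := by
    rw [← rootForm_mul_divDiff hc, h2]; ring
  exact mul_left_cancel₀ h3 ((mul_exQuot ⟨_, h4⟩).trans h4)

lemma zeta_pow_ne_zero (d j : ℕ) : zeta d ^ j ≠ 0 := pow_ne_zero _ (Complex.exp_ne_zero _)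

lemma DZ_eq (d : ℕ) (k : ℕ → ℂ) (f : R2) : DZ d k f = pderiv 0 f -
    ∑ j ∈ Finset.Icc 1 d, C (k j) * divDiff (zeta d ^ j) f := rfl

lemma DW_eq (d : ℕ) (k : ℕ → ℂ) (f : R2) : DW d k f = pderiv 1 f +
    ∑ j ∈ Finset.Icc 1 d, C (k j) * (C (zeta d ^ j) * divDiff (zeta d ^ j) f) := by
  rw [DW, sub_eq_add_neg, ← Finset.sum_neg_distrib]
  congr 1
  refine Finset.sum_congr rfl fun j _ => ?_
  have := exQuot_opposite (zeta_pow_ne_zero d j) f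
  change -(C (k j) * exQuot _ (f - swapAct (zeta d ^ j) f)) = _
  rw [this]; ring

/-- The singular polynomials: the common kernel of the Dunkl operators. -/
def IsSingular (d : ℕ) (k : ℕ → ℂ) (f : R2) : Prop := DZ d k f = 0 ∧ DW d k f = 0

lemma IsSingular.add {d : ℕ} {k : ℕ → ℂ} {f g : R2} (hf : IsSingular d k f)
    (hg : IsSingular d k g) : IsSingular d k (f + g) := by
  obtain ⟨hf1, hf2⟩ := hf
  obtain ⟨hg1, hg2⟩ := hg
  rw [DZ_eq] at hf1 hg1
  rw [DW_eq] at hf2 hg2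
  constructor
  · simp only [DZ_eq, map_add, divDiff_add (zeta_pow_ne_zero d _), mul_add,
      Finset.sum_add_distrib]
    linear_combination hf1 + hg1
  · simp only [DW_eq, map_add, divDiff_add (zeta_pow_ne_zero d _), mul_add,
      Finset.sum_add_distrib]
    linear_combination hf2 + hg2

lemma isSingular_C (d : ℕ) (k : ℕ → ℂ) (a : ℂ) : IsSingular d k (C a) := by
  constructor
  · simp [DZ_eq, divDiff_C (zeta_pow_ne_zero d _)]
  · simp [DW_eq, divDiff_C (zeta_pow_ne_zero d _)]

/-- The product `Z·W` is invariant under every reflection. -/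
lemma swapAct_X_mul_X {c : ℂ} (hc : c ≠ 0) : swapAct c (X 0 * X 1) = X 0 * X 1 := by
  have h1 : (C c * C c⁻¹ : R2) = 1 := by rw [← C_mul, mul_inv_cancel₀ hc, C_1]
  simp only [map_mul, swapAct_X_zero, swapAct_X_one]
  linear_combination X 0 * X 1 * h1

lemma divDiff_invariant_mul {c : ℂ} (hc : c ≠ 0) (b : ℕ) (g : R2) :
    divDiff c ((X 0 * X 1) ^ b * g) = (X 0 * X 1) ^ b * divDiff c g := by
  refine divDiff_eq hc ?_
  rw [map_mul, map_pow, swapAct_X_mul_X hc, mul_left_comm, rootForm_mul_divDiff hc, mul_sub]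

lemma pderiv_zero_invariant_pow_mul (b : ℕ) (g : R2) :
    pderiv (0 : Fin 2) ((X 0 * X 1) ^ (b + 1) * g) =
      X 0 ^ b * X 1 ^ (b + 1) * (C (b + 1 : ℂ) * g + X 0 * pderiv 0 g) := by
  simp [Derivation.leibniz, Derivation.leibniz_pow, pderiv_X, mul_pow]; ring

lemma pderiv_one_invariant_pow_mul (b : ℕ) (g : R2) :
    pderiv (1 : Fin 2) ((X 0 * X 1) ^ (b + 1) * g) =
      X 1 ^ b * X 0 ^ (b + 1) * (C (b + 1 : ℂ) * g + X 1 * pderiv 1 g) := by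
  simp [Derivation.leibniz, Derivation.leibniz_pow, pderiv_X, mul_pow]; ring

lemma dvd_of_dvd_C_mul {a : ℂ} (ha : a ≠ 0) {p g : R2} (h : p ∣ C a * g) : p ∣ g := by
  have : g = C a⁻¹ * (C a * g) := by rw [← mul_assoc, ← C_mul, inv_mul_cancel₀ ha, C_1, one_mul]
  rw [this]; exact h.mul_left _

lemma exists_eq_pow_succ_mul {p f : R2} (hp : ¬ IsUnit p) (hf : f ≠ 0) (h : p ∣ f) :
    ∃ (b : ℕ) (g : R2), f = p ^ (b + 1) * g ∧ ¬ p ∣ g := by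
  obtain ⟨g, hfg, hg⟩ :=
    (FiniteMultiplicity.of_not_isUnit hp hf).exists_eq_pow_mul_and_not_dvd
  generalize multiplicity p f = e at hfg
  rcases e with _ | b
  · rw [pow_zero, one_mul] at hfg
    exact absurd (hfg ▸ h) hg
  · exact ⟨b, g, hfg, hg⟩

/-- A singular polynomial divisible by the invariant `Z·W` vanishes. -/
lemma IsSingular.eq_zero_of_dvd {d : ℕ} {k : ℕ → ℂ} {f : R2} (hf : IsSingular d k f)
    (h : X 0 * X 1 ∣ f) : f = 0 := by
  by_contra h0
  have hX0 : (X 0 : R2) ≠ 0 := X_ne_zero 0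
  have hX1 : (X 1 : R2) ≠ 0 := X_ne_zero 1
  have hunit : ¬ IsUnit (X 0 * X 1 : R2) := fun hu => by
    have := hu.map (aeval (fun _ => 0) : R2 →ₐ[ℂ] ℂ)
    simp at this
  obtain ⟨b, g, rfl, hg⟩ := exists_eq_pow_succ_mul hunit h0 h
  obtain ⟨hZ, hW⟩ := hf
  have hb : (b + 1 : ℂ) ≠ 0 := by exact_mod_cast b.succ_ne_zero
  have hd0 : X 0 ∣ g := by
    refine dvd_of_dvd_C_mul hb ⟨(∑ j ∈ Finset.Icc 1 d, C (k j) * divDiff (zeta d ^ j) g) -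
      pderiv 0 g, ?_⟩
    have hsum : ∑ j ∈ Finset.Icc 1 d,
        C (k j) * divDiff (zeta d ^ j) ((X 0 * X 1) ^ (b + 1) * g) =
        (X 0 * X 1) ^ (b + 1) * ∑ j ∈ Finset.Icc 1 d, C (k j) * divDiff (zeta d ^ j) g := by
      rw [Finset.mul_sum]
      refine Finset.sum_congr rfl fun j _ => ?_
      rw [divDiff_invariant_mul (zeta_pow_ne_zero d j), mul_left_comm]
    rw [DZ_eq, pderiv_zero_invariant_pow_mul, hsum] at hZ
    refine mul_left_cancel₀ (mul_ne_zero (pow_ne_zero b hX0) (pow_ne_zero (b + 1) hX1)) ?_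
    linear_combination hZ
  have hd1 : X 1 ∣ g := by
    refine dvd_of_dvd_C_mul hb ⟨-(∑ j ∈ Finset.Icc 1 d,
      C (k j) * (C (zeta d ^ j) * divDiff (zeta d ^ j) g)) - pderiv 1 g, ?_⟩
    have hsum : ∑ j ∈ Finset.Icc 1 d,
        C (k j) * (C (zeta d ^ j) * divDiff (zeta d ^ j) ((X 0 * X 1) ^ (b + 1) * g)) =
        (X 0 * X 1) ^ (b + 1) * ∑ j ∈ Finset.Icc 1 d,
          C (k j) * (C (zeta d ^ j) * divDiff (zeta d ^ j) g) := by
      rw [Finset.mul_sum]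
      refine Finset.sum_congr rfl fun j _ => ?_
      rw [divDiff_invariant_mul (zeta_pow_ne_zero d j)]
      ring
    rw [DW_eq, pderiv_one_invariant_pow_mul, hsum] at hW
    refine mul_left_cancel₀ (mul_ne_zero (pow_ne_zero b hX1) (pow_ne_zero (b + 1) hX0)) ?_
    linear_combination hW
  obtain ⟨u, rfl⟩ := hd0
  refine hg (mul_dvd_mul_left _ ((X_prime.dvd_or_dvd hd1).resolve_left fun h01 => ?_))
  have := (X_dvd_X (R := ℂ)).1 h01
  simp at this

/-- A polynomial without pure powers of `Z` or `W` is divisible by `Z·W`. -/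
lemma X_mul_X_dvd_of_coeff {f : R2} (h0 : ∀ n, coeff (Finsupp.single 0 n) f = 0)
    (h1 : ∀ n, coeff (Finsupp.single 1 n) f = 0) : X 0 * X 1 ∣ f := by
  rw [f.as_sum]
  refine Finset.dvd_sum fun s hs => ?_
  have hs' := mem_support_iff.1 hs
  have e0 : s 0 ≠ 0 := fun e => hs' <| by
    convert h1 (s 1) using 2
    ext i; fin_cases i <;> simp [e]
  have e1 : s 1 ≠ 0 := fun e => hs' <| by
    convert h0 (s 0) using 2
    ext i; fin_cases i <;> simp [e]
  rw [monomial_eq, Finsupp.prod_fintype _ _ (by simp), Fin.prod_univ_two]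
  exact (mul_dvd_mul (dvd_pow_self _ e0) (dvd_pow_self _ e1)).mul_left _

lemma swapAct_monomial (c : ℂ) (s : Fin 2 →₀ ℕ) (a : ℂ) :
    swapAct c (monomial s a) =
      monomial (Finsupp.single 0 (s 1) + Finsupp.single 1 (s 0)) (a * c ^ s 0 * c⁻¹ ^ s 1) := by
  rw [monomial_eq, Finsupp.prod_fintype _ _ (by simp), Fin.prod_univ_two]
  rw [monomial_add_single, ← C_mul_X_pow_eq_monomial]
  simp only [map_mul, map_pow, swapAct_C, swapAct_X_zero, swapAct_X_one, mul_pow]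
  ring

lemma coeff_single_zero_swapAct (c : ℂ) (n : ℕ) (f : R2) :
    coeff (Finsupp.single 0 n) (swapAct c f) = c⁻¹ ^ n * coeff (Finsupp.single 1 n) f := by
  induction f using MvPolynomial.induction_on' with
  | monomial s a =>
    rw [swapAct_monomial, coeff_monomial, coeff_monomial]
    by_cases h : s = Finsupp.single 1 n
    · subst h
      simp [mul_comm]
    · rw [if_neg h, mul_zero, if_neg]
      intro h'
      apply h
      ext i
      fin_cases i
      · simpa using DFunLike.congr_fun h' 1
      · simpa using DFunLike.congr_fun h' 0
  | add p q hp hq => simp only [map_add, coeff_add, hp, hq, mul_add]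

lemma coeff_single_one_swapAct (c : ℂ) (n : ℕ) (f : R2) :
    coeff (Finsupp.single 1 n) (swapAct c f) = c ^ n * coeff (Finsupp.single 0 n) f := by
  induction f using MvPolynomial.induction_on' with
  | monomial s a =>
    rw [swapAct_monomial, coeff_monomial, coeff_monomial]
    by_cases h : s = Finsupp.single 0 n
    · subst h
      simp [mul_comm]
    · rw [if_neg h, mul_zero, if_neg]
      intro h'
      apply h
      ext i
      fin_cases i
      · simpa using DFunLike.congr_fun h' 1
      · simpa using DFunLike.congr_fun h' 0
  | add p q hp hq => simp only [map_add, coeff_add, hp, hq, mul_add]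

/-- Euler's identity for Dunkl operators, on singular polynomials. -/
lemma IsSingular.euler {d : ℕ} {k : ℕ → ℂ} {f : R2} (hf : IsSingular d k f) :
    X 0 * pderiv 0 f + X 1 * pderiv 1 f =
      ∑ j ∈ Finset.Icc 1 d, C (k j) * (f - swapAct (zeta d ^ j) f) := by
  obtain ⟨hZ, hW⟩ := hf
  rw [DZ_eq] at hZ
  rw [DW_eq] at hW
  have : ∑ j ∈ Finset.Icc 1 d, C (k j) * (f - swapAct (zeta d ^ j) f) =
      X 0 * ∑ j ∈ Finset.Icc 1 d, C (k j) * divDiff (zeta d ^ j) f -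
      X 1 * ∑ j ∈ Finset.Icc 1 d, C (k j) * (C (zeta d ^ j) * divDiff (zeta d ^ j) f) := by
    rw [Finset.mul_sum, Finset.mul_sum, ← Finset.sum_sub_distrib]
    refine Finset.sum_congr rfl fun j _ => ?_
    rw [← rootForm_mul_divDiff (zeta_pow_ne_zero d j), rootForm]
    ring
  rw [this]
  linear_combination X 0 * hZ + X 1 * hW

lemma coeff_single_euler (i : Fin 2) (n : ℕ) (f : R2) :
    coeff (Finsupp.single i n) (X 0 * pderiv 0 f + X 1 * pderiv 1 f) =
      n * coeff (Finsupp.single i n) f := by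
  rcases n with _ | n
  · simp [mul_comm (X _), coeff_mul_X']
  · rw [coeff_add, mul_comm (X 0), mul_comm (X 1), coeff_mul_X', coeff_mul_X']
    fin_cases i <;> simp [coeff_pderiv, ← Finsupp.single_tsub, ← Finsupp.single_add, mul_comm]

lemma IsSingular.coeff_single_zero {d : ℕ} {k : ℕ → ℂ} {f : R2} (hf : IsSingular d k f) (n : ℕ) :
    n * coeff (Finsupp.single 0 n) f =
      (∑ j ∈ Finset.Icc 1 d, k j) * coeff (Finsupp.single 0 n) f -
      (∑ j ∈ Finset.Icc 1 d, k j * ((zeta d ^ n)⁻¹) ^ j) * coeff (Finsupp.single 1 n) f := by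
  rw [← coeff_single_euler, hf.euler, coeff_sum, Finset.sum_mul, Finset.sum_mul,
    ← Finset.sum_sub_distrib]
  refine Finset.sum_congr rfl fun j _ => ?_
  rw [coeff_C_mul, coeff_sub, coeff_single_zero_swapAct]
  ring

lemma IsSingular.coeff_single_one {d : ℕ} {k : ℕ → ℂ} {f : R2} (hf : IsSingular d k f) (n : ℕ) :
    n * coeff (Finsupp.single 1 n) f =
      (∑ j ∈ Finset.Icc 1 d, k j) * coeff (Finsupp.single 1 n) f -
      (∑ j ∈ Finset.Icc 1 d, k j * (zeta d ^ n) ^ j) * coeff (Finsupp.single 0 n) f := by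
  rw [← coeff_single_euler, hf.euler, coeff_sum, Finset.sum_mul, Finset.sum_mul,
    ← Finset.sum_sub_distrib]
  refine Finset.sum_congr rfl fun j _ => ?_
  rw [coeff_C_mul, coeff_sub, coeff_single_one_swapAct]
  ring

/-- Sums over a full period of a periodic function do not depend on the starting point. -/
lemma sum_Ico_add_period {M : Type*} [AddCommMonoid M] [IsCancelAdd M] {d : ℕ} {F : ℕ → M}
    (hF : Function.Periodic F d) (a : ℕ) :
    ∑ i ∈ Finset.Ico a (a + d), F i = ∑ i ∈ Finset.range d, F i := by
  simp only [Finset.sum_Ico_eq_sum_range, add_tsub_cancel_left]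
  induction a with
  | zero => simp
  | succ a ih =>
    rw [← ih]
    apply add_right_cancel (b := F a)
    have h1 := Finset.sum_range_succ (fun i => F (a + i)) d
    have h2 := Finset.sum_range_succ' (fun i => F (a + i)) d
    rw [hF a] at h1
    rw [← h1, h2]
    simp only [add_zero, add_assoc, add_comm 1]

lemma sum_Icc_reflect {M : Type*} [AddCommGroup M] {d : ℕ} {F : ℕ → M}
    (hF : Function.Periodic F d) (b : ℕ) :
    ∑ i ∈ Finset.Icc 1 d, F (b + d - i) = ∑ i ∈ Finset.Icc 1 d, F i := by
  trans ∑ i ∈ Finset.Ico b (b + d), F i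
  · refine Finset.sum_nbij' (fun i => b + d - i) (fun i => b + d - i) ?_ ?_ ?_ ?_ ?_ <;>
      simp only [Finset.mem_Icc, Finset.mem_Ico] <;> intros <;> first | omega | trivial
  · have : Finset.Icc 1 d = Finset.Ico 1 (1 + d) := by ext; simp; omega
    rw [this, sum_Ico_add_period hF, sum_Ico_add_period hF]

/-- The conjugation relation between reflections. -/
lemma swapAct_swapAct {a b c : ℂ} (hb : b ≠ 0) (ha : a ≠ 0) (h : a * c = b ^ 2) (f : R2) :
    swapAct a (swapAct b f) = swapAct b (swapAct c f) := by
  have hc : c = b ^ 2 / a := by field_simp; linear_combination h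
  have : (swapAct a).comp (swapAct b) = (swapAct b).comp (swapAct c) := by
    ext i : 1
    fin_cases i
    · simp only [Fin.zero_eta, AlgHom.comp_apply, swapAct_X_zero, map_mul (swapAct _),
        swapAct_C, swapAct_X_one, ← mul_assoc, ← C_mul, hc]
      congr 2
      field_simp
    · simp only [Fin.mk_one, AlgHom.comp_apply, swapAct_X_zero, map_mul (swapAct _),
        swapAct_C, swapAct_X_one, ← mul_assoc, ← C_mul, hc]
      congr 2
      field_simp
  exact DFunLike.congr_fun this f

lemma divDiff_swapAct {a b c : ℂ} (ha : a ≠ 0) (hb : b ≠ 0) (hc : c ≠ 0) (h : a * c = b ^ 2)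
    (f : R2) : divDiff a (swapAct b f) = -(C (b⁻¹ * c) * swapAct b (divDiff c f)) := by
  refine divDiff_eq ha ?_
  rw [swapAct_swapAct hb ha h, ← map_sub, ← rootForm_mul_divDiff hc, map_mul]
  have : swapAct b (rootForm c) = -C (b⁻¹ * c) * rootForm a := by
    have h' : (C (b⁻¹ * c) * C a : R2) = C b := by
      rw [← C_mul]; congr 1; field_simp; linear_combination h
    simp only [rootForm, map_sub, map_mul, swapAct_X_zero, swapAct_X_one, swapAct_C]
    rw [C_mul] at h'
    linear_combination -X 1 * h'
  rw [this]; ring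

lemma pderiv_zero_swapAct (c : ℂ) (f : R2) :
    pderiv 0 (swapAct c f) = C c⁻¹ * swapAct c (pderiv 1 f) := by
  induction f using MvPolynomial.induction_on with
  | C a => simp
  | add p q hp hq => simp only [map_add, hp, hq, mul_add]
  | mul_X p i hp =>
    fin_cases i
    · simp [Derivation.leibniz, hp, pderiv_X]; ring
    · simp [Derivation.leibniz, hp, pderiv_X]; ring

lemma pderiv_one_swapAct (c : ℂ) (f : R2) :
    pderiv 1 (swapAct c f) = C c * swapAct c (pderiv 0 f) := by
  induction f using MvPolynomial.induction_on with
  | C a => simp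
  | add p q hp hq => simp only [map_add, hp, hq, mul_add]
  | mul_X p i hp =>
    fin_cases i
    · simp [Derivation.leibniz, hp, pderiv_X]; ring
    · simp [Derivation.leibniz, hp, pderiv_X]; ring

/-- The parameters attached to the two conjugacy classes of reflections. -/
def parityParam (k₁ k₂ : ℂ) (j : ℕ) : ℂ := if j % 2 = 1 then k₁ else k₂

lemma isPrimitiveRoot_zeta {d : ℕ} (hd : d ≠ 0) : IsPrimitiveRoot (zeta d) d :=
  Complex.isPrimitiveRoot_exp d hd

/-- The reflections permute the singular polynomials. -/
lemma IsSingular.swapAct {m : ℕ} (hm : m ≠ 0) {k₁ k₂ : ℂ} {f : R2}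
    (hf : IsSingular (2 * m) (parityParam k₁ k₂) f) (j : ℕ) :
    IsSingular (2 * m) (parityParam k₁ k₂) (swapAct (zeta (2 * m) ^ j) f) := by
  obtain ⟨hZ, hW⟩ := hf
  set k := parityParam k₁ k₂ with hk
  set z := zeta (2 * m) with hz
  have hz0 : ∀ i, z ^ i ≠ 0 := zeta_pow_ne_zero (2 * m)
  have hz1 : z ^ (2 * m) = 1 := (isPrimitiveRoot_zeta (by omega)).pow_eq_one
  have hkper : ∀ i, k (i + 2 * m) = k i := fun i => by simp [hk, parityParam]
  have hzper : ∀ i, z ^ (i + 2 * m) = z ^ i := fun i => by rw [pow_add, hz1, mul_one]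
  have hkref : ∀ i ∈ Finset.Icc 1 (2 * m), k i = k (2 * j + 2 * m - i) := fun i hi => by
    rw [Finset.mem_Icc] at hi
    have : (2 * j + 2 * m - i) % 2 = i % 2 := by omega
    simp only [hk, parityParam, this]
  have hzref : ∀ i ∈ Finset.Icc 1 (2 * m), z ^ i * z ^ (2 * j + 2 * m - i) = (z ^ j) ^ 2 :=
    fun i hi => by
      rw [Finset.mem_Icc] at hi
      rw [← pow_add, show i + (2 * j + 2 * m - i) = 2 * j + 2 * m by omega, hzper, mul_comm 2 j,
        pow_mul]
  have hbb : (C (z ^ j) * C (z ^ j)⁻¹ : R2) = 1 := by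
    rw [← C_mul, mul_inv_cancel₀ (hz0 j), C_1]
  rw [DZ_eq] at hZ
  rw [DW_eq] at hW
  constructor
  · have hsum := sum_Icc_reflect (d := 2 * m)
      (F := fun i => C (k i) * (C (z ^ i) * divDiff (z ^ i) f))
      (fun i => by simp only [hkper, hzper]) (2 * j)
    have : ∑ i ∈ Finset.Icc 1 (2 * m), C (k i) * divDiff (z ^ i) (_root_.swapAct (z ^ j) f) =
        -(C (z ^ j)⁻¹ * _root_.swapAct (z ^ j)
          (∑ i ∈ Finset.Icc 1 (2 * m), C (k i) * (C (z ^ i) * divDiff (z ^ i) f))) := by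
      rw [← hsum, map_sum, Finset.mul_sum, ← Finset.sum_neg_distrib]
      refine Finset.sum_congr rfl fun i hi => ?_
      rw [divDiff_swapAct (hz0 i) (hz0 j) (hz0 _) (hzref i hi), hkref i hi]
      simp only [map_mul, swapAct_C]
      ring
    rw [DZ_eq, pderiv_zero_swapAct, this, sub_neg_eq_add, ← mul_add, ← map_add, hW]
    simp
  · have hsum := sum_Icc_reflect (d := 2 * m)
      (F := fun i => C (k i) * divDiff (z ^ i) f)
      (fun i => by simp only [hkper, hzper]) (2 * j)
    have : ∑ i ∈ Finset.Icc 1 (2 * m),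
        C (k i) * (C (z ^ i) * divDiff (z ^ i) (_root_.swapAct (z ^ j) f)) =
        -(C (z ^ j) * _root_.swapAct (z ^ j)
          (∑ i ∈ Finset.Icc 1 (2 * m), C (k i) * divDiff (z ^ i) f)) := by
      rw [← hsum, map_sum, Finset.mul_sum, ← Finset.sum_neg_distrib]
      refine Finset.sum_congr rfl fun i hi => ?_
      have hC : (C (z ^ i) * C (z ^ (2 * j + 2 * m - i)) : R2) = C (z ^ j) ^ 2 := by
        rw [← C_mul, hzref i hi, C_pow]
      rw [divDiff_swapAct (hz0 i) (hz0 j) (hz0 _) (hzref i hi), hkref i hi, C_mul]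
      simp only [map_mul (_root_.swapAct _), swapAct_C]
      linear_combination (-C (k (2 * j + 2 * m - i)) * C (z ^ j)⁻¹ *
        _root_.swapAct (z ^ j) (divDiff (z ^ (2 * j + 2 * m - i)) f)) * hC -
        C (k (2 * j + 2 * m - i)) * C (z ^ j) *
        _root_.swapAct (z ^ j) (divDiff (z ^ (2 * j + 2 * m - i)) f) * hbb
    rw [DW_eq, pderiv_one_swapAct, this, ← sub_eq_add_neg, ← mul_sub, ← map_sub, hZ]
    simp

/-- A nonzero singular polynomial which every reflection negates forces `k₁` to be a positive
half-integer: the order of vanishing along a mirror is odd and equal to `2 k₁`. -/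
lemma IsSingular.eq_zero_of_antiinvariant {m : ℕ} (hm : m ≠ 0) {k₁ k₂ : ℂ}
    (hb : ∀ i : ℕ, k₁ ≠ (i : ℂ) + 1 / 2) {f : R2}
    (hf : IsSingular (2 * m) (parityParam k₁ k₂) f)
    (hanti : ∀ j, _root_.swapAct (zeta (2 * m) ^ j) f = -f) : f = 0 := by
  by_contra h0
  set z := zeta (2 * m) with hz
  have hprim : IsPrimitiveRoot z (2 * m) := isPrimitiveRoot_zeta (by omega)
  have hz0 : ∀ i, z ^ i ≠ 0 := zeta_pow_ne_zero (2 * m)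
  have hz' : z ≠ 0 := by simpa using hz0 1
  have hα := prime_rootForm z
  have hdiff : ∀ i, rootForm (z ^ i) * divDiff (z ^ i) f = C 2 * f := fun i => by
    rw [rootForm_mul_divDiff (hz0 i), hanti i, show (C 2 : R2) = 2 from rfl]; ring
  have hdvd : rootForm z ∣ f :=
    dvd_of_dvd_C_mul two_ne_zero ⟨divDiff z f, by simpa using (hdiff 1).symm⟩
  obtain ⟨e, g, hfg, hg⟩ := exists_eq_pow_succ_mul hα.not_isUnit h0 hdvd
  have hrest : ∀ i ∈ (Finset.Icc 1 (2 * m)).erase 1,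
      rootForm z ^ (e + 1) ∣ C (parityParam k₁ k₂ i) * divDiff (z ^ i) f := fun i hi => by
    rw [Finset.mem_erase, Finset.mem_Icc] at hi
    refine Dvd.dvd.mul_left (hα.pow_dvd_of_dvd_mul_left _ (rootForm_not_dvd_rootForm fun h => ?_)
      ((hdiff i).symm ▸ (Dvd.intro _ hfg.symm).mul_left _)) _
    have h1 : z ^ (i - 1) = 1 := by
      apply mul_right_cancel₀ hz'
      rw [one_mul, ← pow_succ, show i - 1 + 1 = i by omega, ← h]
    have := Nat.le_of_dvd (by omega) (hprim.dvd_of_pow_eq_one _ h1)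
    omega
  have hfirst : divDiff z f = C 2 * (rootForm z ^ e * g) := by
    apply mul_left_cancel₀ hα.ne_zero
    have := hdiff 1
    rw [pow_one] at this
    rw [this, hfg]; ring
  have hderiv : pderiv 0 f =
      C (e + 1 : ℂ) * (rootForm z ^ e * g) + rootForm z ^ (e + 1) * pderiv 0 g := by
    rw [hfg]
    simp [Derivation.leibniz, Derivation.leibniz_pow, rootForm, pderiv_X]; ring
  have hZ := hf.1
  rw [DZ_eq, ← Finset.add_sum_erase _ _ (Finset.mem_Icc.2 ⟨le_refl 1, by omega⟩), ← hz, pow_one,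
    hfirst, hderiv, show parityParam k₁ k₂ 1 = k₁ by simp [parityParam]] at hZ
  obtain ⟨q, hq⟩ := Finset.dvd_sum hrest
  rw [hq] at hZ
  have hmain : rootForm z ∣ C (e + 1 - 2 * k₁ : ℂ) * g := by
    refine ⟨q - pderiv 0 g, mul_left_cancel₀ (pow_ne_zero e hα.ne_zero) ?_⟩
    rw [C_sub, C_mul (a := 2)]
    linear_combination hZ
  have hk : (e + 1 - 2 * k₁ : ℂ) = 0 := by
    by_contra h
    exact hg (dvd_of_dvd_C_mul h hmain)
  rcases Nat.even_or_odd' e with ⟨i, rfl | rfl⟩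
  · apply hb i
    push_cast at hk
    linear_combination -hk / 2
  · have hneg : _root_.swapAct z (rootForm z) = -rootForm z := by
      have h1 : (C z * C z⁻¹ : R2) = 1 := by rw [← C_mul, mul_inv_cancel₀ hz', C_1]
      simp only [rootForm, map_sub, map_mul, swapAct_X_zero, swapAct_X_one, swapAct_C]
      linear_combination -X 0 * h1
    have h1 := hanti 1
    rw [pow_one, hfg, map_mul, map_pow, hneg, Even.neg_pow ⟨i + 1, by ring⟩, ← mul_neg] at h1
    have h2 := mul_left_cancel₀ (pow_ne_zero _ hα.ne_zero) h1
    have h3 := rootForm_dvd_sub_swapAct hz' g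
    rw [h2, sub_neg_eq_add, ← two_mul] at h3
    exact hg (dvd_of_dvd_C_mul (a := 2) two_ne_zero h3)

lemma sum_parityParam (m : ℕ) (k₁ k₂ η : ℂ) :
    ∑ j ∈ Finset.Icc 1 (2 * m), parityParam k₁ k₂ j * η ^ j =
      (k₁ * η + k₂ * η ^ 2) * ∑ t ∈ Finset.range m, (η ^ 2) ^ t := by
  induction m with
  | zero => simp
  | succ m ih =>
    rw [show 2 * (m + 1) = 2 * m + 1 + 1 by ring, Finset.sum_Icc_succ_top (by omega),
      Finset.sum_Icc_succ_top (by omega), ih, Finset.sum_range_succ]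
    have h1 : parityParam k₁ k₂ (2 * m + 1) = k₁ := by simp [parityParam]
    have h2 : parityParam k₁ k₂ (2 * m + 1 + 1) = k₂ := by simp [parityParam, add_assoc]
    rw [h1, h2]
    ring

lemma sum_parityParam_eq_zero {m : ℕ} {k₁ k₂ η : ℂ} (h : η ^ (2 * m) = 1) (h2 : η ^ 2 ≠ 1) :
    ∑ j ∈ Finset.Icc 1 (2 * m), parityParam k₁ k₂ j * η ^ j = 0 := by
  rw [sum_parityParam, geom_sum_eq h2, ← pow_mul, h, sub_self, zero_div, mul_zero]

lemma sum_parityParam_of_sq_eq_one {m : ℕ} {k₁ k₂ η : ℂ} (h2 : η ^ 2 = 1) :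
    ∑ j ∈ Finset.Icc 1 (2 * m), parityParam k₁ k₂ j * η ^ j = m * (k₁ * η + k₂) := by
  rw [sum_parityParam, h2]
  simp [mul_comm]

/-- Pure powers cancel in `f + swapAct (ζ ^ j) f` for singular `f` without constant term. -/
lemma IsSingular.coeff_single_add {m : ℕ} (hm : m ≠ 0) {k₁ k₂ : ℂ}
    (ha : ∀ r : ℕ, 0 < r → ¬ m ∣ r → k₁ + k₂ ≠ (r : ℂ) / (m : ℂ))
    (hb : ∀ i : ℕ, k₁ ≠ (i : ℂ) + 1 / 2) (hc : ∀ i : ℕ, k₂ ≠ (i : ℂ) + 1 / 2) {f : R2}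
    (hf : IsSingular (2 * m) (parityParam k₁ k₂) f) {n : ℕ} (hn : 0 < n) (j : ℕ) :
    coeff (Finsupp.single 0 n) f + ((zeta (2 * m) ^ j)⁻¹) ^ n * coeff (Finsupp.single 1 n) f = 0 ∧
    coeff (Finsupp.single 1 n) f + (zeta (2 * m) ^ j) ^ n * coeff (Finsupp.single 0 n) f = 0 := by
  have hx := hf.coeff_single_zero n
  have hy := hf.coeff_single_one n
  set x := coeff (Finsupp.single 0 n) f
  set y := coeff (Finsupp.single 1 n) f
  set z := zeta (2 * m) with hz
  have hprim : IsPrimitiveRoot z (2 * m) := isPrimitiveRoot_zeta (by omega)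
  have hm' : (m : ℂ) ≠ 0 := by exact_mod_cast hm
  have hn' : (n : ℂ) ≠ 0 := by exact_mod_cast hn.ne'
  have hp : ∑ j ∈ Finset.Icc 1 (2 * m), parityParam k₁ k₂ j = m * (k₁ + k₂) := by
    have := sum_parityParam_of_sq_eq_one (m := m) (k₁ := k₁) (k₂ := k₂) (one_pow 2)
    simpa using this
  have hzn : (z ^ n) ^ (2 * m) = 1 := by rw [← pow_mul, mul_comm, pow_mul, hprim.pow_eq_one, one_pow]
  rw [hp] at hx hy
  suffices h : (x = 0 ∧ y = 0) ∨ (z ^ n = 1 ∧ x + y = 0) by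
    rcases h with ⟨h1, h2⟩ | ⟨h1, h2⟩
    · simp [h1, h2]
    · have h3 : (z ^ j) ^ n = 1 := by rw [← pow_mul, mul_comm, pow_mul, h1, one_pow]
      rw [inv_pow, h3]
      constructor <;> linear_combination h2
  by_cases hmn : m ∣ n
  · have hsq : (z ^ n) ^ 2 = 1 := by
      obtain ⟨t, rfl⟩ := hmn
      rw [← pow_mul, show m * t * 2 = 2 * m * t by ring, pow_mul, hprim.pow_eq_one, one_pow]
    rw [sum_parityParam_of_sq_eq_one (by rw [inv_pow, hsq, inv_one])] at hx
    rw [sum_parityParam_of_sq_eq_one hsq] at hy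
    rcases sq_eq_one_iff.1 hsq with h1 | h1
    · right
      rw [h1] at hx hy
      refine ⟨h1, mul_left_cancel₀ hn' ?_⟩
      rw [inv_one] at hx
      linear_combination hx + hy
    · left
      rw [h1] at hx hy
      obtain ⟨i, hi⟩ : ∃ i, n = m * (2 * i + 1) := by
        obtain ⟨t, rfl⟩ := hmn
        rcases Nat.even_or_odd' t with ⟨i, rfl | rfl⟩
        · rw [show m * (2 * i) = 2 * m * i by ring, pow_mul, hprim.pow_eq_one, one_pow] at h1
          norm_num at h1
        · exact ⟨i, rfl⟩
      have hn2 : (n : ℂ) = m * (2 * i + 1) := by exact_mod_cast hi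
      have h2 : (m : ℂ) * (2 * i + 1 - 2 * k₁) ≠ 0 := mul_ne_zero hm' fun h => hb i (by
        linear_combination -h / 2)
      have h3 : (m : ℂ) * (2 * i + 1 - 2 * k₂) ≠ 0 := mul_ne_zero hm' fun h => hc i (by
        linear_combination -h / 2)
      rw [hn2] at hx hy
      rw [inv_neg, inv_one] at hx
      have hadd : x + y = 0 := mul_left_cancel₀ h2 (by linear_combination hx + hy)
      have hsub : x - y = 0 := mul_left_cancel₀ h3 (by linear_combination hx - hy)
      exact ⟨by linear_combination (hadd + hsub) / 2, by linear_combination (hadd - hsub) / 2⟩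
  · left
    have hne : (z ^ n) ^ 2 ≠ 1 := fun h => by
      rw [← pow_mul, mul_comm] at h
      exact hmn ((Nat.mul_dvd_mul_iff_left two_pos).1 (hprim.dvd_of_pow_eq_one _ h))
    rw [sum_parityParam_eq_zero (by rw [inv_pow, hzn, inv_one])
      (by rwa [inv_pow, ne_eq, inv_eq_one])] at hx
    rw [sum_parityParam_eq_zero hzn hne] at hy
    have hne' : (n : ℂ) - m * (k₁ + k₂) ≠ 0 := fun h => ha n hn hmn (by
      field_simp; linear_combination -h)
    constructor
    · apply mul_left_cancel₀ hne'; linear_combination hx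
    · apply mul_left_cancel₀ hne'; linear_combination hy

lemma IsSingular.eq_zero_of_coeff_zero {m : ℕ} (hm : m ≠ 0) {k₁ k₂ : ℂ}
    (ha : ∀ r : ℕ, 0 < r → ¬ m ∣ r → k₁ + k₂ ≠ (r : ℂ) / (m : ℂ))
    (hb : ∀ i : ℕ, k₁ ≠ (i : ℂ) + 1 / 2) (hc : ∀ i : ℕ, k₂ ≠ (i : ℂ) + 1 / 2) {f : R2}
    (hf : IsSingular (2 * m) (parityParam k₁ k₂) f) (h0 : coeff 0 f = 0) : f = 0 := by
  refine hf.eq_zero_of_antiinvariant hm hb fun j => ?_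
  refine eq_neg_of_add_eq_zero_right ((hf.add (hf.swapAct hm j)).eq_zero_of_dvd
    (X_mul_X_dvd_of_coeff (fun n => ?_) fun n => ?_))
  · rw [coeff_add, coeff_single_zero_swapAct]
    rcases Nat.eq_zero_or_pos n with rfl | hn
    · simp [h0]
    · exact (hf.coeff_single_add hm ha hb hc hn j).1
  · rw [coeff_add, coeff_single_one_swapAct]
    rcases Nat.eq_zero_or_pos n with rfl | hn
    · simp [h0]
    · exact (hf.coeff_single_add hm ha hb hc hn j).2

/-- For even `d = 2m`, if `k₁ + k₂ ≠ r/m` for every positive integer `r` not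
divisible by `m`, and neither `k₁` nor `k₂` is of the form `i + 1/2` with `i ≥ 0`
an integer, then every singular polynomial is constant. -/
theorem even_no_singular (m : ℕ) (hm : 2 ≤ m) (k₁ k₂ : ℂ)
    (ha : ∀ r : ℕ, 0 < r → ¬ m ∣ r → k₁ + k₂ ≠ (r : ℂ) / (m : ℂ))
    (hb : ∀ i : ℕ, k₁ ≠ (i : ℂ) + 1 / 2)
    (hc : ∀ i : ℕ, k₂ ≠ (i : ℂ) + 1 / 2) :
    ∀ f : R2, DZ (2 * m) (fun j => if j % 2 = 1 then k₁ else k₂) f = 0 →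
      DW (2 * m) (fun j => if j % 2 = 1 then k₁ else k₂) f = 0 →
      ∃ a : ℂ, f = C a := by
  intro f hZ hW
  refine ⟨coeff 0 f, ?_⟩
  have hf : IsSingular (2 * m) (parityParam k₁ k₂) (f + C (-coeff 0 f)) :=
    IsSingular.add ⟨hZ, hW⟩ (isSingular_C _ _ _)
  have := hf.eq_zero_of_coeff_zero (by omega) ha hb hc (by simp)
  rw [C_neg] at this
  linear_combination this

end
end
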